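/- arXiv:1512.00404 — 8 statements merged into one kernel-verified Lean document; each statement's English description precedes it below -/
import Mathlib

section
/- If M is an intra-regular po-Γ-semigroup then, for every x, y ∈ M and every γ ∈ Γ, we have (MΓ{xγy}ΓM] = (MΓ{yγx}ΓM]. -/
namespace PGS

variable {M : Type*} {Γ : Type*}

/-- `AΓB = {aγb : a ∈ A, b ∈ B, γ ∈ Γ}`. -/
def gprod (op : Γ → M → M → M) (A B : Set M) : Set M :=
  {x | ∃ a ∈ A, ∃ b ∈ B, ∃ γ : Γ, x = op γ a b}

/-- `(H] = {t : t ≤ h for some h ∈ H}`. -/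
def dcl [PartialOrder M] (H : Set M) : Set M :=
  {t | ∃ h ∈ H, t ≤ h}

/-- `M` with the family of operations `op : Γ → M → M → M` and the partial order `≤`
is a po-Γ-semigroup: `(aγb)μc = aγ(bμc)` and the order is compatible with the operations. -/
def IsPoGammaSemigroup [PartialOrder M] (op : Γ → M → M → M) : Prop :=
  (∀ (a b c : M) (γ μ : Γ), op μ (op γ a b) c = op γ a (op μ b c)) ∧
  (∀ (a b c : M) (γ : Γ), a ≤ b → op γ a c ≤ op γ b c) ∧
  (∀ (a b c : M) (γ : Γ), a ≤ b → op γ c a ≤ op γ c b)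

/-- Left ideal of `M`: `MΓA ⊆ A` and `A` is downward closed. -/
def IsLeftIdeal [PartialOrder M] (op : Γ → M → M → M) (A : Set M) : Prop :=
  gprod op Set.univ A ⊆ A ∧ ∀ a ∈ A, ∀ b : M, b ≤ a → b ∈ A

/-- Right ideal of `M`: `AΓM ⊆ A` and `A` is downward closed. -/
def IsRightIdeal [PartialOrder M] (op : Γ → M → M → M) (A : Set M) : Prop :=
  gprod op A Set.univ ⊆ A ∧ ∀ a ∈ A, ∀ b : M, b ≤ a → b ∈ A

/-- Ideal of `M`: both a left and a right ideal. -/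
def IsIdeal [PartialOrder M] (op : Γ → M → M → M) (A : Set M) : Prop :=
  IsLeftIdeal op A ∧ IsRightIdeal op A

/-- A prime subset: `aγb ∈ T` implies `a ∈ T` or `b ∈ T`. -/
def IsPrimeSubset (op : Γ → M → M → M) (T : Set M) : Prop :=
  ∀ (a b : M) (γ : Γ), op γ a b ∈ T → a ∈ T ∨ b ∈ T

/-- A semiprime subset: `aγa ∈ T` implies `a ∈ T`. -/
def IsSemiprimeSubset (op : Γ → M → M → M) (T : Set M) : Prop :=
  ∀ (a : M) (γ : Γ), op γ a a ∈ T → a ∈ T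

/-- A weakly prime subset: for all ideals `A`, `B` of `M` with `AΓB ⊆ T`,
`A ⊆ T` or `B ⊆ T`. -/
def IsWeaklyPrimeSubset [PartialOrder M] (op : Γ → M → M → M) (T : Set M) : Prop :=
  ∀ A B : Set M, IsIdeal op A → IsIdeal op B → gprod op A B ⊆ T → A ⊆ T ∨ B ⊆ T

/-- Intra-regular: `x ∈ (MΓ{xγx}ΓM]` for all `x`, `γ`. -/
def IsIntraRegular [PartialOrder M] (op : Γ → M → M → M) : Prop :=
  ∀ (x : M) (γ : Γ),
    x ∈ dcl (gprod op (gprod op Set.univ {op γ x x}) Set.univ)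

/-- Left regular: `x ∈ (MΓ{xγx}]` for all `x`, `γ`. -/
def IsLeftRegular [PartialOrder M] (op : Γ → M → M → M) : Prop :=
  ∀ (x : M) (γ : Γ), x ∈ dcl (gprod op Set.univ {op γ x x})

/-- Left duo: every left ideal of `M` is an ideal of `M`. -/
def IsLeftDuo [PartialOrder M] (op : Γ → M → M → M) : Prop :=
  ∀ A : Set M, IsLeftIdeal op A → IsIdeal op A

/-- A subsemigroup: a nonempty subset `T` with `TΓT ⊆ T`. -/
def IsSubsemigroup (op : Γ → M → M → M) (T : Set M) : Prop :=
  T.Nonempty ∧ gprod op T T ⊆ T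

/-- An ideal of a subsemigroup `T`: a nonempty subset `I` of `T` with `TΓI ⊆ I`,
`IΓT ⊆ I`, closed downward inside `T`. -/
def IsIdealOfSub [PartialOrder M] (op : Γ → M → M → M) (T I : Set M) : Prop :=
  I.Nonempty ∧ I ⊆ T ∧ gprod op T I ⊆ I ∧ gprod op I T ⊆ I ∧
    ∀ a ∈ I, ∀ b ∈ T, b ≤ a → b ∈ I

/-- A left ideal of a subsemigroup `T`: a nonempty subset `I` of `T` with `TΓI ⊆ I`,
closed downward inside `T`. -/
def IsLeftIdealOfSub [PartialOrder M] (op : Γ → M → M → M) (T I : Set M) : Prop :=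
  I.Nonempty ∧ I ⊆ T ∧ gprod op T I ⊆ I ∧ ∀ a ∈ I, ∀ b ∈ T, b ≤ a → b ∈ I

/-- A simple subsemigroup: a subsemigroup having no ideal other than itself. -/
def IsSimpleSub [PartialOrder M] (op : Γ → M → M → M) (T : Set M) : Prop :=
  IsSubsemigroup op T ∧ ∀ I : Set M, IsIdealOfSub op T I → I = T

/-- A left simple subsemigroup: a subsemigroup having no left ideal other than itself. -/
def IsLeftSimpleSub [PartialOrder M] (op : Γ → M → M → M) (T : Set M) : Prop :=
  IsSubsemigroup op T ∧ ∀ I : Set M, IsLeftIdealOfSub op T I → I = T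

/-- A filter of `M`: a subsemigroup `F` such that `aγb ∈ F` implies `a ∈ F` and `b ∈ F`,
and `F` is upward closed. -/
def IsFilterSub [PartialOrder M] (op : Γ → M → M → M) (F : Set M) : Prop :=
  IsSubsemigroup op F ∧ (∀ (a b : M) (γ : Γ), op γ a b ∈ F → a ∈ F ∧ b ∈ F) ∧
    ∀ a ∈ F, ∀ c : M, a ≤ c → c ∈ F

/-- `N(x)`: the least filter of `M` containing `x`. -/
def Nfil [PartialOrder M] (op : Γ → M → M → M) (x : M) : Set M :=
  ⋂₀ {F : Set M | IsFilterSub op F ∧ x ∈ F}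

/-- The `𝒩`-class `(x)_𝒩` of `x`, where `a 𝒩 b` iff `N(a) = N(b)`. -/
def Ncls [PartialOrder M] (op : Γ → M → M → M) (x : M) : Set M :=
  {y | Nfil op y = Nfil op x}

/-- `L(a) = ({a} ∪ MΓ{a}]`, the left ideal of `M` generated by `a`. -/
def Lgen [PartialOrder M] (op : Γ → M → M → M) (a : M) : Set M :=
  dcl ({a} ∪ gprod op Set.univ {a})

/-- `I(a) = ({a} ∪ MΓ{a} ∪ {a}ΓM ∪ MΓ{a}ΓM]`, the ideal of `M` generated by `a`. -/
def Igen [PartialOrder M] (op : Γ → M → M → M) (a : M) : Set M :=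
  dcl ({a} ∪ gprod op Set.univ {a} ∪ gprod op {a} Set.univ ∪
    gprod op (gprod op Set.univ {a}) Set.univ)

/-- A semilattice congruence on `M`. -/
def IsSemilatticeCong (op : Γ → M → M → M) (σ : M → M → Prop) : Prop :=
  Equivalence σ ∧
  (∀ (a b c : M) (γ : Γ), σ a b → σ (op γ a c) (op γ b c)) ∧
  (∀ (a b c : M) (γ : Γ), σ a b → σ (op γ c a) (op γ c b)) ∧
  (∀ (a b : M) (γ : Γ), σ (op γ a b) (op γ b a)) ∧
  (∀ (a : M) (γ : Γ), σ (op γ a a) a)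

/-- The `σ`-class of `x`. -/
def cls (σ : M → M → Prop) (x : M) : Set M := {y | σ y x}

/-- `M` is a semilattice of simple semigroups. -/
def IsSemilatticeOfSimple [PartialOrder M] (op : Γ → M → M → M) : Prop :=
  ∃ σ : M → M → Prop, IsSemilatticeCong op σ ∧ ∀ x : M, IsSimpleSub op (cls σ x)

/-- `M` is a semilattice of left simple semigroups. -/
def IsSemilatticeOfLeftSimple [PartialOrder M] (op : Γ → M → M → M) : Prop :=
  ∃ σ : M → M → Prop, IsSemilatticeCong op σ ∧ ∀ x : M, IsLeftSimpleSub op (cls σ x)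

/-- `M` is a chain of simple semigroups. -/
def IsChainOfSimple [PartialOrder M] (op : Γ → M → M → M) : Prop :=
  ∃ σ : M → M → Prop, IsSemilatticeCong op σ ∧ (∀ x : M, IsSimpleSub op (cls σ x)) ∧
    ∀ (x y : M) (γ : Γ), cls σ x = cls σ (op γ x y) ∨ cls σ y = cls σ (op γ x y)


/-- In an intra-regular po-Γ-semigroup, `(MΓ{xγy}ΓM] ⊆ (MΓ{yγx}ΓM]`. -/
theorem dcl_gprod_op_subset_swap [PartialOrder M] {op : Γ → M → M → M}
    (hM : IsPoGammaSemigroup op) (hir : IsIntraRegular op) (x y : M) (γ : Γ) :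
    dcl (gprod op (gprod op Set.univ {op γ x y}) Set.univ) ⊆
      dcl (gprod op (gprod op Set.univ {op γ y x}) Set.univ) := by
  obtain ⟨assoc, mono_left, mono_right⟩ := hM
  rintro t ⟨_, ⟨_, ⟨a, -, _, rfl, α, rfl⟩, b, -, β, rfl⟩, ht⟩
  obtain ⟨_, ⟨_, ⟨u, -, _, rfl, μ, rfl⟩, v, -, ν, rfl⟩, hz⟩ := hir (op γ x y) γ
  refine ⟨_, ⟨_, ⟨op α a (op μ u x), trivial, _, rfl, γ, rfl⟩,
    op β (op ν y v) b, trivial, γ, rfl⟩, ?_⟩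
  refine ht.trans ((mono_left _ _ b β (mono_right _ _ a α hz)).trans_eq ?_)
  simp only [assoc]

theorem statement_2 [PartialOrder M] [Nonempty M] [Nonempty Γ]
    (op : Γ → M → M → M) (hM : IsPoGammaSemigroup op)
    (hir : IsIntraRegular op) :
    ∀ (x y : M) (γ : Γ),
      dcl (gprod op (gprod op Set.univ {op γ x y}) Set.univ) =
        dcl (gprod op (gprod op Set.univ {op γ y x}) Set.univ) := fun x y γ =>
  (dcl_gprod_op_subset_swap hM hir x y γ).antisymm (dcl_gprod_op_subset_swap hM hir y x γ)

end PGS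
end

section
/- A po-Γ-semigroup M is intra-regular if and only if, for every x ∈ M, N(x) = {y ∈ M : x ∈ (MΓ{y}ΓM]}. -/
namespace PGS

variable {M : Type*} {Γ : Type*}

theorem mem_dcl_gprod_iff [PartialOrder M] {op : Γ → M → M → M} {x y : M} :
    x ∈ dcl (gprod op (gprod op Set.univ {y}) Set.univ) ↔
      ∃ (u v : M) (α β : Γ), x ≤ op β (op α u y) v := by
  constructor
  · rintro ⟨_, ⟨_, ⟨u, -, _, rfl, α, rfl⟩, v, -, β, rfl⟩, h⟩
    exact ⟨u, v, α, β, h⟩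
  · rintro ⟨u, v, α, β, h⟩
    exact ⟨_, ⟨_, ⟨u, trivial, y, rfl, α, rfl⟩, v, trivial, β, rfl⟩, h⟩

/-- In an intra-regular po-Γ-semigroup, the elements `y` with `x ∈ (MΓ{y}ΓM]` form a filter. -/
theorem IsIntraRegular.isFilterSub [PartialOrder M] [Nonempty Γ] {op : Γ → M → M → M}
    (hM : IsPoGammaSemigroup op) (h : IsIntraRegular op) (x : M) :
    IsFilterSub op {y : M | x ∈ dcl (gprod op (gprod op Set.univ {y}) Set.univ)} ∧
      x ∈ dcl (gprod op (gprod op Set.univ {x}) Set.univ) := by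
  obtain ⟨assoc, monoL, monoR⟩ := hM
  have hself : x ∈ dcl (gprod op (gprod op Set.univ {x}) Set.univ) := by
    obtain ⟨γ⟩ := ‹Nonempty Γ›
    obtain ⟨u, v, α, β, hx⟩ := mem_dcl_gprod_iff.1 (h x γ)
    exact mem_dcl_gprod_iff.2 ⟨op α u x, v, γ, β, by rwa [assoc u x x]⟩
  refine ⟨⟨⟨⟨x, hself⟩, ?_⟩, ?_, ?_⟩, hself⟩
  · rintro _ ⟨a, ha, b, hb, γ, rfl⟩
    obtain ⟨u, v, α, β, ha⟩ := mem_dcl_gprod_iff.1 ha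
    obtain ⟨w, z, δ, ε, hb⟩ := mem_dcl_gprod_iff.1 hb
    obtain ⟨p, q, κ, μ, hx⟩ := mem_dcl_gprod_iff.1 (h x γ)
    obtain ⟨r, s, ρ, σ, ht⟩ :=
      mem_dcl_gprod_iff.1 (h (op ε b (op γ z (op α u a))) γ)
    have hxx : op γ x x ≤ op γ (op ε (op δ w b) z) (op β (op α u a) v) :=
      (monoL _ _ _ γ hb).trans (monoR _ _ _ γ ha)
    have hx' := hx.trans (monoL _ _ q μ (monoR _ _ p κ hxx))
    have ht' := monoL _ _ q μ (monoR _ _ p κ (monoR _ _ w δ (monoL _ _ v β ht)))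
    refine mem_dcl_gprod_iff.2 ⟨op κ p (op δ w (op ρ r (op ε b (op γ z u)))),
      op γ z (op α u (op σ a (op β s (op μ v q)))),
      α, ε, ?_⟩
    simp only [assoc] at hx' ht' ⊢
    exact hx'.trans ht'
  · intro a b γ hab
    obtain ⟨u, v, α, β, hx⟩ := mem_dcl_gprod_iff.1 hab
    exact ⟨mem_dcl_gprod_iff.2 ⟨u, op β b v, α, γ, by simpa only [assoc] using hx⟩,
      mem_dcl_gprod_iff.2 ⟨op α u a, v, γ, β, by simpa only [assoc] using hx⟩⟩
  · intro a ha c hac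
    obtain ⟨u, v, α, β, hx⟩ := mem_dcl_gprod_iff.1 ha
    exact mem_dcl_gprod_iff.2
      ⟨u, v, α, β, hx.trans (monoL _ _ v β (monoR _ _ u α hac))⟩

theorem statement_3 [PartialOrder M] [Nonempty M] [Nonempty Γ]
    (op : Γ → M → M → M) (hM : IsPoGammaSemigroup op) :
    IsIntraRegular op ↔
      ∀ x : M, Nfil op x =
        {y : M | x ∈ dcl (gprod op (gprod op Set.univ {y}) Set.univ)} := by
  refine ⟨fun h x => Set.Subset.antisymm ?_ ?_, fun h x γ => ?_⟩
  · exact Set.sInter_subset_of_mem (h.isFilterSub hM x)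
  · rintro y hy F ⟨⟨-, hfac, hup⟩, hxF⟩
    obtain ⟨u, v, α, β, hx⟩ := mem_dcl_gprod_iff.1 hy
    exact (hfac _ _ _ (hfac _ _ _ (hup x hxF _ hx)).1).2
  · have hxx : op γ x x ∈ Nfil op x :=
      fun F hF => hF.1.1.2 ⟨x, hF.2, x, hF.2, γ, rfl⟩
    rwa [h x] at hxx

end PGS
end

section
/- A po-Γ-semigroup M is intra-regular if and only if every ideal of M is semiprime. -/
namespace PGS

variable {M : Type*} {Γ : Type*}

/-- `(MΓ{c}ΓM]` is an ideal of `M`. -/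
theorem isIdeal_dcl_gprod_gprod [PartialOrder M] {op : Γ → M → M → M}
    (hM : IsPoGammaSemigroup op) (c : M) :
    IsIdeal op (dcl (gprod op (gprod op Set.univ {c}) Set.univ)) := by
  obtain ⟨assoc, mono_left, mono_right⟩ := hM
  have lower : ∀ a ∈ dcl (gprod op (gprod op Set.univ {c}) Set.univ), ∀ b : M, b ≤ a →
      b ∈ dcl (gprod op (gprod op Set.univ {c}) Set.univ) :=
    fun a ⟨h, hh, hah⟩ b hba => ⟨h, hh, hba.trans hah⟩
  refine ⟨⟨?_, lower⟩, ⟨?_, lower⟩⟩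
  · rintro _ ⟨m, -, t, ⟨_, ⟨_, ⟨a, -, _, rfl, α, rfl⟩, b, -, β, rfl⟩, ht⟩, γ, rfl⟩
    refine ⟨_, ⟨_, ⟨op γ m a, trivial, _, rfl, α, rfl⟩, b, trivial, β, rfl⟩, ?_⟩
    simpa only [assoc] using mono_right _ _ m γ ht
  · rintro _ ⟨t, ⟨_, ⟨_, ⟨a, -, _, rfl, α, rfl⟩, b, -, β, rfl⟩, ht⟩, m, -, γ, rfl⟩
    refine ⟨_, ⟨_, ⟨a, trivial, _, rfl, α, rfl⟩, op γ b m, trivial, β, rfl⟩, ?_⟩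
    simpa only [assoc] using mono_left _ _ m γ ht

theorem statement_5 [PartialOrder M] [Nonempty M] [Nonempty Γ]
    (op : Γ → M → M → M) (hM : IsPoGammaSemigroup op) :
    IsIntraRegular op ↔ ∀ I : Set M, IsIdeal op I → IsSemiprimeSubset op I := by
  constructor
  · intro h I hI a γ ha
    obtain ⟨t, ⟨_, ⟨m, -, _, rfl, α, rfl⟩, n, -, β, rfl⟩, hat⟩ := h a γ
    refine hI.1.2 _ (hI.2.1 ⟨_, hI.1.1 ⟨m, trivial, _, ha, α, rfl⟩, n, trivial, β, rfl⟩) a hat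
  · intro h x γ
    have semiprime := h _ (isIdeal_dcl_gprod_gprod hM (op γ x x))
    refine semiprime x γ (semiprime (op γ x x) γ ?_)
    refine ⟨_, ⟨_, ⟨x, trivial, _, rfl, γ, rfl⟩, x, trivial, γ, rfl⟩, ?_⟩
    simp only [hM.1, le_refl]

end PGS
end

section
/- Let M be a po-Γ-semigroup. Every ideal of M is idempotent (i.e., A = (AΓA] for every ideal A of M) if and only if for any two ideals A, B of M we have A ∩ B = (AΓB]. -/
namespace PGS

variable {M : Type*} {Γ : Type*}

section
variable [PartialOrder M] {op : Γ → M → M → M} {A B : Set M}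

theorem IsIdeal.op_mem_right (hA : IsIdeal op A) {a : M} (ha : a ∈ A) (γ : Γ) (m : M) :
    op γ a m ∈ A :=
  hA.2.1 ⟨a, ha, m, Set.mem_univ m, γ, rfl⟩

theorem IsIdeal.op_mem_left (hA : IsIdeal op A) {a : M} (ha : a ∈ A) (γ : Γ) (m : M) :
    op γ m a ∈ A :=
  hA.1.1 ⟨m, Set.mem_univ m, a, ha, γ, rfl⟩

theorem IsIdeal.inter (hA : IsIdeal op A) (hB : IsIdeal op B) : IsIdeal op (A ∩ B) := by
  refine ⟨⟨?_, fun a ha b hb => ⟨hA.1.2 a ha.1 b hb, hB.1.2 a ha.2 b hb⟩⟩,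
    ⟨?_, fun a ha b hb => ⟨hA.1.2 a ha.1 b hb, hB.1.2 a ha.2 b hb⟩⟩⟩
  · rintro _ ⟨m, -, a, ha, γ, rfl⟩
    exact ⟨hA.op_mem_left ha.1 γ m, hB.op_mem_left ha.2 γ m⟩
  · rintro _ ⟨a, ha, m, -, γ, rfl⟩
    exact ⟨hA.op_mem_right ha.1 γ m, hB.op_mem_right ha.2 γ m⟩

theorem IsIdeal.inter_nonempty [Nonempty Γ] (hA : IsIdeal op A) (hA' : A.Nonempty)
    (hB : IsIdeal op B) (hB' : B.Nonempty) : (A ∩ B).Nonempty := by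
  obtain ⟨a, ha⟩ := hA'
  obtain ⟨b, hb⟩ := hB'
  obtain ⟨γ⟩ := ‹Nonempty Γ›
  exact ⟨op γ a b, hA.op_mem_right ha γ b, hB.op_mem_left hb γ a⟩

theorem IsIdeal.dcl_gprod_subset_inter (hA : IsIdeal op A) (hB : IsIdeal op B) :
    dcl (gprod op A B) ⊆ A ∩ B := by
  rintro t ⟨_, ⟨a, ha, b, hb, γ, rfl⟩, ht⟩
  exact ⟨hA.1.2 _ (hA.op_mem_right ha γ b) t ht, hB.1.2 _ (hB.op_mem_left hb γ a) t ht⟩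

end

theorem statement_8 [PartialOrder M] [Nonempty M] [Nonempty Γ]
    (op : Γ → M → M → M) (hM : IsPoGammaSemigroup op) :
    (∀ A : Set M, IsIdeal op A → A.Nonempty → A = dcl (gprod op A A)) ↔
      (∀ A B : Set M, IsIdeal op A → A.Nonempty → IsIdeal op B → B.Nonempty →
        A ∩ B = dcl (gprod op A B)) := by
  refine ⟨fun h A B hA hA' hB hB' => (subset_antisymm ?_ (hA.dcl_gprod_subset_inter hB)),
    fun h A hA hA' => by simpa using h A A hA hA' hA hA'⟩
  intro x hx
  rw [h (A ∩ B) (hA.inter hB) (hA.inter_nonempty hA' hB hB')] at hx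
  obtain ⟨_, ⟨a, ha, b, hb, γ, rfl⟩, hxy⟩ := hx
  exact ⟨_, ⟨a, ha.1, b, hb.2, γ, rfl⟩, hxy⟩

end PGS
end

section
/- Let M be a po-Γ-semigroup. If M is intra-regular, then I(x) = (MΓ{x}ΓM] for every x ∈ M. -/
namespace PGS

variable {M : Type*} {Γ : Type*}

/-- In an intra-regular po-`Γ`-semigroup every `x` lies below some `(mαx)γk`. -/
lemma IsIntraRegular.exists_le [PartialOrder M] [Nonempty Γ] {op : Γ → M → M → M}
    (hM : IsPoGammaSemigroup op) (hir : IsIntraRegular op) (x : M) :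
    ∃ (m k : M) (α γ : Γ), x ≤ op γ (op α m x) k := by
  obtain ⟨γ⟩ := ‹Nonempty Γ›
  obtain ⟨_, ⟨_, ⟨m, -, _, rfl, α, rfl⟩, n, -, β, rfl⟩, hx⟩ := hir x γ
  refine ⟨m, op β x n, α, γ, ?_⟩
  rwa [← hM.1 m x x α γ, hM.1 _ x n γ β] at hx

theorem statement_10 [PartialOrder M] [Nonempty M] [Nonempty Γ]
    (op : Γ → M → M → M) (hM : IsPoGammaSemigroup op)
    (hir : IsIntraRegular op) :
    ∀ x : M, Igen op x = dcl (gprod op (gprod op Set.univ {x}) Set.univ) := by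
  intro x
  obtain ⟨m, k, α, γ, hx⟩ := hir.exists_le hM x
  obtain ⟨assoc, mono_left, mono_right⟩ := hM
  have mem : ∀ {t p q : M} {δ ε : Γ}, t ≤ op ε (op δ p x) q →
      t ∈ dcl (gprod op (gprod op Set.univ {x}) Set.univ) := fun {t p q δ ε} h =>
    ⟨_, ⟨_, ⟨p, trivial, x, rfl, δ, rfl⟩, q, trivial, ε, rfl⟩, h⟩
  ext t
  constructor
  · rintro ⟨h, ((hh | ⟨p, -, _, rfl, δ, rfl⟩) | ⟨_, rfl, p, -, δ, rfl⟩) | hh, ht⟩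
    · obtain rfl : h = x := hh
      exact mem (ht.trans hx)
    · have hle := ht.trans (mono_right _ _ p δ hx)
      rw [← assoc, ← assoc] at hle
      exact mem hle
    · have hle := ht.trans (mono_left _ _ p δ hx)
      rw [assoc (op α m _)] at hle
      exact mem hle
    · exact ⟨h, hh, ht⟩
  · rintro ⟨h, hh, ht⟩
    exact ⟨h, Or.inr hh, ht⟩

end PGS
end

section
/- If M is a po-Γ-semigroup, x, y ∈ M and γ ∈ Γ, then I(xγy) ⊆ I(x) ∩ I(y). In particular, if M is intra-regular, then I(xγy) = I(x) ∩ I(y). -/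
namespace PGS

variable {M : Type*} {Γ : Type*}

theorem mem_Igen_self [PartialOrder M] (op : Γ → M → M → M) (a : M) : a ∈ Igen op a :=
  ⟨a, Or.inl (Or.inl (Or.inl rfl)), le_rfl⟩

theorem Igen_subset [PartialOrder M] {op : Γ → M → M → M} {A : Set M} (hA : IsIdeal op A)
    {a : M} (ha : a ∈ A) : Igen op a ⊆ A := by
  have hl : ∀ m γ, op γ m a ∈ A := fun m γ => hA.1.1 ⟨m, trivial, a, ha, γ, rfl⟩
  rintro t ⟨h, hh, hth⟩
  refine hA.1.2 h ?_ t hth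
  rcases hh with ((rfl | ⟨m, -, _, rfl, γ, rfl⟩) | ⟨_, rfl, m, -, γ, rfl⟩) |
    ⟨_, ⟨m, -, _, rfl, γ, rfl⟩, n, -, μ, rfl⟩
  · exact ha
  · exact hl m γ
  · exact hA.2.1 ⟨_, ha, m, trivial, γ, rfl⟩
  · exact hA.2.1 ⟨_, hl m γ, n, trivial, μ, rfl⟩

theorem IsPoGammaSemigroup.isIdeal_Igen [PartialOrder M] {op : Γ → M → M → M}
    (hM : IsPoGammaSemigroup op) (a : M) : IsIdeal op (Igen op a) := by
  obtain ⟨assoc, mono_left, mono_right⟩ := hM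
  have down : ∀ t ∈ Igen op a, ∀ b, b ≤ t → b ∈ Igen op a := by
    rintro t ⟨h, hh, hth⟩ b hb
    exact ⟨h, hh, hb.trans hth⟩
  refine ⟨⟨?_, down⟩, ?_, down⟩
  · rintro _ ⟨k, -, t, ⟨h, hh, hth⟩, δ, rfl⟩
    refine ⟨op δ k h, ?_, mono_right _ _ _ _ hth⟩
    rcases hh with ((rfl | ⟨m, -, _, rfl, γ, rfl⟩) | ⟨_, rfl, m, -, γ, rfl⟩) |
      ⟨_, ⟨m, -, _, rfl, γ, rfl⟩, n, -, μ, rfl⟩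
    · exact Or.inl (Or.inl (Or.inr ⟨k, trivial, _, rfl, δ, rfl⟩))
    · exact Or.inl (Or.inl (Or.inr ⟨op δ k m, trivial, _, rfl, γ, (assoc ..).symm⟩))
    · exact Or.inr ⟨_, ⟨k, trivial, _, rfl, δ, rfl⟩, m, trivial, γ, (assoc ..).symm⟩
    · exact Or.inr ⟨_, ⟨op δ k m, trivial, _, rfl, γ, rfl⟩, n, trivial, μ, by simp only [assoc]⟩
  · rintro _ ⟨t, ⟨h, hh, hth⟩, k, -, δ, rfl⟩
    refine ⟨op δ h k, ?_, mono_left _ _ _ _ hth⟩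
    rcases hh with ((rfl | ⟨m, -, _, rfl, γ, rfl⟩) | ⟨_, rfl, m, -, γ, rfl⟩) |
      ⟨_, ⟨m, -, _, rfl, γ, rfl⟩, n, -, μ, rfl⟩
    · exact Or.inl (Or.inr ⟨_, rfl, k, trivial, δ, rfl⟩)
    · exact Or.inr ⟨_, ⟨m, trivial, _, rfl, γ, rfl⟩, k, trivial, δ, rfl⟩
    · exact Or.inl (Or.inr ⟨_, rfl, op δ m k, trivial, γ, assoc ..⟩)
    · exact Or.inr ⟨_, ⟨m, trivial, _, rfl, γ, rfl⟩, op δ n k, trivial, μ, assoc ..⟩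

theorem IsIntraRegular.isSemiprimeSubset [PartialOrder M] {op : Γ → M → M → M}
    (hR : IsIntraRegular op) {A : Set M} (hA : IsIdeal op A) : IsSemiprimeSubset op A := by
  intro a γ ha
  obtain ⟨_, ⟨_, ⟨m, -, _, rfl, μ, rfl⟩, n, -, ν, rfl⟩, hle⟩ := hR a γ
  exact hA.1.2 _ (hA.2.1 ⟨_, hA.1.1 ⟨m, trivial, _, ha, μ, rfl⟩, n, trivial, ν, rfl⟩) _ hle

/-- The elements `b` with `yΓb ⊆ A` and `yΓMΓb ⊆ A` form an ideal. -/
theorem IsPoGammaSemigroup.isIdeal_right_colon [PartialOrder M] {op : Γ → M → M → M}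
    (hM : IsPoGammaSemigroup op) {A : Set M} (hA : IsIdeal op A) (y : M) :
    IsIdeal op {b | (∀ μ, op μ y b ∈ A) ∧ ∀ μ w ν, op μ y (op ν w b) ∈ A} := by
  obtain ⟨assoc, -, mono_right⟩ := hM
  have down : ∀ b ∈ {b | (∀ μ, op μ y b ∈ A) ∧ ∀ μ w ν, op μ y (op ν w b) ∈ A}, ∀ c, c ≤ b →
      c ∈ {b | (∀ μ, op μ y b ∈ A) ∧ ∀ μ w ν, op μ y (op ν w b) ∈ A} :=
    fun b hb c hc => ⟨fun μ => hA.1.2 _ (hb.1 μ) _ (mono_right _ _ _ _ hc), fun μ w ν =>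
      hA.1.2 _ (hb.2 μ w ν) _ (mono_right _ _ _ _ (mono_right _ _ _ _ hc))⟩
  refine ⟨⟨?_, down⟩, ?_, down⟩
  · rintro _ ⟨k, -, b, hb, δ, rfl⟩
    exact ⟨fun μ => hb.2 μ k δ, fun μ w ν => by rw [← assoc w]; exact hb.2 ..⟩
  · rintro _ ⟨b, hb, k, -, δ, rfl⟩
    refine ⟨fun μ => ?_, fun μ w ν => ?_⟩
    · rw [← assoc]
      exact hA.2.1 ⟨_, hb.1 μ, k, trivial, δ, rfl⟩
    · rw [← assoc w, ← assoc y]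
      exact hA.2.1 ⟨_, hb.2 μ w ν, k, trivial, δ, rfl⟩

/-- The elements `a` with `aΓb ⊆ A` and `aΓMΓb ⊆ A` form an ideal. -/
theorem IsPoGammaSemigroup.isIdeal_left_colon [PartialOrder M] {op : Γ → M → M → M}
    (hM : IsPoGammaSemigroup op) {A : Set M} (hA : IsIdeal op A) (b : M) :
    IsIdeal op {a | (∀ μ, op μ a b ∈ A) ∧ ∀ μ w ν, op μ a (op ν w b) ∈ A} := by
  obtain ⟨assoc, mono_left, -⟩ := hM
  have down : ∀ a ∈ {a | (∀ μ, op μ a b ∈ A) ∧ ∀ μ w ν, op μ a (op ν w b) ∈ A}, ∀ c, c ≤ a →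
      c ∈ {a | (∀ μ, op μ a b ∈ A) ∧ ∀ μ w ν, op μ a (op ν w b) ∈ A} :=
    fun a ha c hc => ⟨fun μ => hA.1.2 _ (ha.1 μ) _ (mono_left _ _ _ _ hc), fun μ w ν =>
      hA.1.2 _ (ha.2 μ w ν) _ (mono_left _ _ _ _ hc)⟩
  refine ⟨⟨?_, down⟩, ?_, down⟩
  · rintro _ ⟨k, -, a, ha, δ, rfl⟩
    refine ⟨fun μ => ?_, fun μ w ν => ?_⟩
    · rw [assoc]
      exact hA.1.1 ⟨k, trivial, _, ha.1 μ, δ, rfl⟩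
    · rw [assoc]
      exact hA.1.1 ⟨k, trivial, _, ha.2 μ w ν, δ, rfl⟩
  · rintro _ ⟨a, ha, k, -, δ, rfl⟩
    refine ⟨fun μ => ?_, fun μ w ν => ?_⟩
    · rw [assoc]
      exact ha.2 ..
    · rw [assoc, ← assoc k]
      exact ha.2 ..

/-- A semiprime ideal containing `xγy` contains `I(x) ∩ I(y)`. -/
theorem IsPoGammaSemigroup.Igen_inter_subset [PartialOrder M] {op : Γ → M → M → M}
    (hM : IsPoGammaSemigroup op) {A : Set M} (hA : IsIdeal op A) (hS : IsSemiprimeSubset op A)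
    {x y : M} {γ : Γ} (hxy : op γ x y ∈ A) : Igen op x ∩ Igen op y ⊆ A := by
  have assoc := hM.1
  have key : ∀ u v μ ν, op ν (op μ u (op γ x y)) v ∈ A := fun u v μ ν =>
    hA.2.1 ⟨_, hA.1.1 ⟨u, trivial, _, hxy, μ, rfl⟩, v, trivial, ν, rfl⟩
  have hx : x ∈ {b | (∀ μ, op μ y b ∈ A) ∧ ∀ μ w ν, op μ y (op ν w b) ∈ A} := by
    refine ⟨fun μ => hS _ γ ?_, fun μ w ν => hS _ γ ?_⟩
    · simpa only [assoc] using key y x μ μ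
    · simpa only [assoc] using key (op μ y w) (op ν w x) ν μ
  rintro z ⟨hzx, hzy⟩
  have hyz := Igen_subset (hM.isIdeal_right_colon hA y) hx hzx
  have hzz := Igen_subset (hM.isIdeal_left_colon hA z) hyz hzy
  exact hS z γ (hzz.1 γ)

theorem statement_11 [PartialOrder M] [Nonempty M] [Nonempty Γ]
    (op : Γ → M → M → M) (hM : IsPoGammaSemigroup op) :
    (∀ (x y : M) (γ : Γ), Igen op (op γ x y) ⊆ Igen op x ∩ Igen op y) ∧
    (IsIntraRegular op →
      ∀ (x y : M) (γ : Γ), Igen op (op γ x y) = Igen op x ∩ Igen op y) := by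
  have sub : ∀ (x y : M) (γ : Γ), Igen op (op γ x y) ⊆ Igen op x ∩ Igen op y :=
    fun x y γ => Set.subset_inter
      (Igen_subset (hM.isIdeal_Igen x)
        ((hM.isIdeal_Igen x).2.1 ⟨x, mem_Igen_self op x, y, trivial, γ, rfl⟩))
      (Igen_subset (hM.isIdeal_Igen y)
        ((hM.isIdeal_Igen y).1.1 ⟨x, trivial, y, mem_Igen_self op y, γ, rfl⟩))
  refine ⟨sub, fun hR x y γ => (sub x y γ).antisymm ?_⟩
  have hI := hM.isIdeal_Igen (op γ x y)
  exact hM.Igen_inter_subset hI (hR.isSemiprimeSubset hI) (mem_Igen_self op _)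

end PGS
end

section
/- Let M be a po-Γ-semigroup, T a subsemigroup of M and x ∈ T. Then the set (MΓ{x}ΓM] ∩ T is an ideal of T (T regarded as a po-Γ-semigroup under the induced operations and order). -/
namespace PGS

variable {M : Type*} {Γ : Type*}

theorem gprod_univ_dcl_two_sided_subset [PartialOrder M] {op : Γ → M → M → M}
    (hM : IsPoGammaSemigroup op) (x : M) :
    gprod op Set.univ (dcl (gprod op (gprod op Set.univ {x}) Set.univ)) ⊆
      dcl (gprod op (gprod op Set.univ {x}) Set.univ) := by
  rintro _ ⟨t, -, a, ⟨_, ⟨_, ⟨m, -, _, rfl, γ, rfl⟩, n, -, μ, rfl⟩, ha⟩, ν, rfl⟩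
  refine ⟨op μ (op γ (op ν t m) _) n,
    ⟨_, ⟨op ν t m, trivial, _, rfl, γ, rfl⟩, n, trivial, μ, rfl⟩, ?_⟩
  rw [hM.1 t m, hM.1 t]
  exact hM.2.2 _ _ _ _ ha

theorem gprod_dcl_two_sided_univ_subset [PartialOrder M] {op : Γ → M → M → M}
    (hM : IsPoGammaSemigroup op) (x : M) :
    gprod op (dcl (gprod op (gprod op Set.univ {x}) Set.univ)) Set.univ ⊆
      dcl (gprod op (gprod op Set.univ {x}) Set.univ) := by
  rintro _ ⟨a, ⟨_, ⟨p, hp, n, -, μ, rfl⟩, ha⟩, t, -, ν, rfl⟩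
  refine ⟨op μ p (op ν n t), ⟨p, hp, op ν n t, trivial, μ, rfl⟩, ?_⟩
  rw [← hM.1]
  exact hM.2.1 _ _ _ _ ha

theorem statement_15 [PartialOrder M] [Nonempty M] [Nonempty Γ]
    (op : Γ → M → M → M) (hM : IsPoGammaSemigroup op)
    (T : Set M) (hT : IsSubsemigroup op T) (x : M) (hx : x ∈ T) :
    IsIdealOfSub op T (dcl (gprod op (gprod op Set.univ {x}) Set.univ) ∩ T) := by
  have mul_mem {a b : M} (ha : a ∈ T) (hb : b ∈ T) (γ : Γ) : op γ a b ∈ T :=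
    hT.2 ⟨a, ha, b, hb, γ, rfl⟩
  refine ⟨?_, Set.inter_subset_right, ?_, ?_, ?_⟩
  · obtain ⟨γ⟩ := ‹Nonempty Γ›
    exact ⟨op γ (op γ x x) x,
      ⟨_, ⟨_, ⟨x, trivial, x, rfl, γ, rfl⟩, x, trivial, γ, rfl⟩, le_rfl⟩,
      mul_mem (mul_mem hx hx γ) hx γ⟩
  · rintro _ ⟨t, ht, a, ⟨ha, haT⟩, γ, rfl⟩
    exact ⟨gprod_univ_dcl_two_sided_subset hM x ⟨t, trivial, a, ha, γ, rfl⟩, mul_mem ht haT γ⟩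
  · rintro _ ⟨a, ⟨ha, haT⟩, t, ht, γ, rfl⟩
    exact ⟨gprod_dcl_two_sided_univ_subset hM x ⟨a, ha, t, trivial, γ, rfl⟩, mul_mem haT ht γ⟩
  · rintro a ⟨⟨h, hh, hah⟩, -⟩ b hb hba
    exact ⟨⟨h, hh, hba.trans hah⟩, hb⟩

end PGS
end

section
/- Let M be an intra-regular po-Γ-semigroup. If T is a maximal simple subsemigroup of M (i.e., T is a simple subsemigroup and every simple subsemigroup containing T equals T), then there exists x ∈ M such that T = (x)_𝒩. -/
namespace PGS

variable {M : Type*} {Γ : Type*}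

/-- `DivBy op x y` says `x ∈ (MΓ{y}ΓM]`. -/
def DivBy [PartialOrder M] (op : Γ → M → M → M) (x y : M) : Prop :=
  ∃ (a b : M) (α β : Γ), x ≤ op β (op α a y) b

section

variable [PartialOrder M] {op : Γ → M → M → M}

theorem DivBy.of_le_left {x y z : M} (h : x ≤ y) (hyz : DivBy op y z) : DivBy op x z := by
  obtain ⟨a, b, α, β, hy⟩ := hyz
  exact ⟨a, b, α, β, h.trans hy⟩

theorem DivBy.of_le_right (hM : IsPoGammaSemigroup op) {x y z : M} (hxy : DivBy op x y)
    (h : y ≤ z) : DivBy op x z := by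
  obtain ⟨a, b, α, β, hx⟩ := hxy
  exact ⟨a, b, α, β, hx.trans (hM.2.1 _ _ _ _ (hM.2.2 _ _ _ _ h))⟩

theorem DivBy.fst (hM : IsPoGammaSemigroup op) {x y z : M} {γ : Γ}
    (h : DivBy op x (op γ y z)) : DivBy op x y := by
  obtain ⟨a, b, α, β, hx⟩ := h
  exact ⟨a, op β z b, α, γ, by simpa only [hM.1] using hx⟩

theorem DivBy.snd (hM : IsPoGammaSemigroup op) {x y z : M} {γ : Γ}
    (h : DivBy op x (op γ y z)) : DivBy op x z := by
  obtain ⟨a, b, α, β, hx⟩ := h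
  exact ⟨op α a y, b, γ, β, by simpa only [hM.1] using hx⟩

theorem DivBy.trans (hM : IsPoGammaSemigroup op) {x y z : M} (hxy : DivBy op x y)
    (hyz : DivBy op y z) : DivBy op x z := by
  obtain ⟨a, b, α, β, hy⟩ := hyz
  exact ((hxy.of_le_right hM hy).fst hM).snd hM

theorem IsIntraRegular.divBy_mul_self (hir : IsIntraRegular op) (x : M) (γ : Γ) :
    DivBy op x (op γ x x) := by
  obtain ⟨_, ⟨_, ⟨a, -, _, rfl, α, rfl⟩, b, -, β, rfl⟩, h⟩ := hir x γ
  exact ⟨a, b, α, β, h⟩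

theorem IsIntraRegular.divBy_refl [Nonempty Γ] (hM : IsPoGammaSemigroup op)
    (hir : IsIntraRegular op) (x : M) : DivBy op x x :=
  (hir.divBy_mul_self x (Classical.arbitrary Γ)).fst hM

theorem IsIntraRegular.divBy_mul [Nonempty Γ] (hM : IsPoGammaSemigroup op)
    (hir : IsIntraRegular op) {x y z : M} (hy : DivBy op x y) (hz : DivBy op x z) (μ : Γ) :
    DivBy op x (op μ y z) := by
  obtain ⟨a, b, α, β, hxy⟩ := hy
  obtain ⟨c, d, γ, δ, hxz⟩ := hz
  have hczdayb : DivBy op x (op δ (op δ (op γ c z) d) (op β (op α a y) b)) :=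
    ((hir.divBy_mul_self x δ).of_le_right hM (hM.2.1 _ _ _ _ hxz)).of_le_right hM
      (hM.2.2 _ _ _ _ hxy)
  have hzday : DivBy op x (op δ z (op δ d (op α a y))) := by
    refine DivBy.fst hM (z := b) (γ := β) (DivBy.snd hM (y := c) (γ := γ) ?_)
    simpa only [hM.1] using hczdayb
  have hsq := hzday.trans hM (hir.divBy_mul_self _ μ)
  refine DivBy.fst hM (z := op δ d (op α a y)) (γ := δ)
    (DivBy.snd hM (y := op δ z (op δ d a)) (γ := α) ?_)
  simpa only [hM.1] using hsq

theorem mem_Nfil_iff [Nonempty Γ] (hM : IsPoGammaSemigroup op) (hir : IsIntraRegular op)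
    {x y : M} : y ∈ Nfil op x ↔ DivBy op x y := by
  constructor
  · refine fun h => h {y | DivBy op x y}
      ⟨⟨⟨⟨x, hir.divBy_refl hM x⟩, ?_⟩, ?_, ?_⟩, hir.divBy_refl hM x⟩
    · rintro _ ⟨a, ha, b, hb, γ, rfl⟩
      exact hir.divBy_mul hM ha hb γ
    · exact fun a b γ h => ⟨DivBy.fst hM h, DivBy.snd hM h⟩
    · exact fun a ha c hac => DivBy.of_le_right hM ha hac
  · rintro ⟨a, b, α, β, h⟩ F ⟨hF, hx⟩
    exact (hF.2.1 _ _ _ (hF.2.1 _ _ _ (hF.2.2 _ hx _ h)).1).2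

theorem mem_Ncls_iff [Nonempty Γ] (hM : IsPoGammaSemigroup op) (hir : IsIntraRegular op)
    {x y : M} : y ∈ Ncls op x ↔ DivBy op x y ∧ DivBy op y x := by
  constructor
  · intro h
    have h : Nfil op y = Nfil op x := h
    rw [← mem_Nfil_iff hM hir, ← mem_Nfil_iff hM hir, ← h, mem_Nfil_iff hM hir, h,
      mem_Nfil_iff hM hir]
    exact ⟨hir.divBy_refl hM y, hir.divBy_refl hM x⟩
  · rintro ⟨hxy, hyx⟩
    ext z
    rw [mem_Nfil_iff hM hir, mem_Nfil_iff hM hir]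
    exact ⟨hxy.trans hM, hyx.trans hM⟩

theorem isSimpleSub_Ncls [Nonempty Γ] (hM : IsPoGammaSemigroup op) (hir : IsIntraRegular op)
    (x : M) : IsSimpleSub op (Ncls op x) := by
  refine ⟨⟨⟨x, rfl⟩, ?_⟩, ?_⟩
  · rintro _ ⟨a, ha, b, hb, γ, rfl⟩
    rw [mem_Ncls_iff hM hir] at ha hb ⊢
    exact ⟨hir.divBy_mul hM ha.1 hb.1 γ, ((hir.divBy_refl hM _).fst hM).trans hM ha.2⟩
  · rintro I ⟨⟨a, ha⟩, hIC, hCI, hIC', hdown⟩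
    refine hIC.antisymm fun b hb => ?_
    obtain ⟨γ⟩ := ‹Nonempty Γ›
    have haC := (mem_Ncls_iff hM hir).1 (hIC ha)
    have hbC := (mem_Ncls_iff hM hir).1 hb
    have hba := hbC.2.trans hM haC.1
    obtain ⟨c, d, α, β, h⟩ := hir.divBy_mul hM (hir.divBy_mul hM hba hba γ) hba γ
    have hle : b ≤ op γ (op γ (op α c a) a) (op β a d) := by simpa only [hM.1] using h
    have hdiv := (hir.divBy_refl hM b).of_le_right hM hle
    have hca : op α c a ∈ Ncls op x := (mem_Ncls_iff hM hir).2
      ⟨hbC.1.trans hM ((hdiv.fst hM).fst hM), ((hir.divBy_refl hM _).snd hM).trans hM haC.2⟩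
    have had : op β a d ∈ Ncls op x := (mem_Ncls_iff hM hir).2
      ⟨hbC.1.trans hM (hdiv.snd hM), ((hir.divBy_refl hM _).fst hM).trans hM haC.2⟩
    exact hdown _ (hIC' ⟨_, hCI ⟨_, hca, _, ha, γ, rfl⟩, _, had, γ, rfl⟩) b hb hle

theorem IsSimpleSub.divBy [Nonempty Γ] (hM : IsPoGammaSemigroup op) (hir : IsIntraRegular op)
    {T : Set M} (hT : IsSimpleSub op T) {x y : M} (hx : x ∈ T) (hy : y ∈ T) : DivBy op x y := by
  have h : {t | t ∈ T ∧ DivBy op t y} = T := by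
    refine hT.2 _ ⟨⟨y, hy, hir.divBy_refl hM y⟩, fun t ht => ht.1, ?_, ?_, ?_⟩
    · rintro _ ⟨s, hs, t, ht, γ, rfl⟩
      exact ⟨hT.1.2 ⟨s, hs, t, ht.1, γ, rfl⟩, ((hir.divBy_refl hM _).snd hM).trans hM ht.2⟩
    · rintro _ ⟨t, ht, s, hs, γ, rfl⟩
      exact ⟨hT.1.2 ⟨t, ht.1, s, hs, γ, rfl⟩, ((hir.divBy_refl hM _).fst hM).trans hM ht.2⟩
    · exact fun t ht s hs hst => ⟨hs, ht.2.of_le_left hst⟩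
  exact (h.ge hx).2

end

theorem statement_17 [PartialOrder M] [Nonempty M] [Nonempty Γ]
    (op : Γ → M → M → M) (hM : IsPoGammaSemigroup op)
    (hir : IsIntraRegular op)
    (T : Set M) (hT : IsSimpleSub op T)
    (hmax : ∀ T' : Set M, IsSimpleSub op T' → T ⊆ T' → T' = T) :
    ∃ x : M, T = Ncls op x := by
  obtain ⟨x, hx⟩ := hT.1.1
  exact ⟨x, (hmax _ (isSimpleSub_Ncls hM hir x) fun y hy =>
    (mem_Ncls_iff hM hir).2 ⟨hT.divBy hM hir hx hy, hT.divBy hM hir hy hx⟩).symm⟩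

end PGS
end
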